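/- Let H be a group DAG on a grouping W of a finite node set N in which every group has size exactly 1. Then every distribution p on N that is groupwise faithful to H given W is faithful to some DAG on N (namely the DAG on N obtained from H by identifying each singleton group with its unique element). -/

import Mathlib

open scoped Classical

namespace GroupBN

variable {V : Type*} {I : Type*}

/-- `u` and `v` are adjacent in the digraph with arc relation `A`. -/
def Adj (A : V → V → Prop) (u v : V) : Prop := A u v ∨ A v u

/-- `A` is the arc relation of a DAG: there are no directed cycles
(in particular `A` is irreflexive). -/
def IsDAG (A : V → V → Prop) : Prop := ∀ v : V, ¬ Relation.TransGen A v v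

/-- `u` is an ancestor of `v`: there is a nonempty directed path from `u` to `v`. -/
def Ancestor (A : V → V → Prop) (u v : V) : Prop := Relation.TransGen A u v

/-- `u` and `v` are d-connected given `Z`: there is a path (an injective sequence of
pairwise adjacent consecutive nodes) from `u` to `v` such that every head-to-head
interior node is in `Z` or has a descendant in `Z`, and no other interior node is
in `Z`. -/
def DConn (A : V → V → Prop) (Z : Set V) (u v : V) : Prop :=
  ∃ (n : ℕ) (pth : Fin (n + 2) → V),
    Function.Injective pth ∧
    pth 0 = u ∧ pth (Fin.last (n + 1)) = v ∧
    (∀ (k : ℕ) (h : k + 1 < n + 2),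
      Adj A (pth ⟨k, Nat.lt_of_succ_lt h⟩) (pth ⟨k + 1, h⟩)) ∧
    (∀ (k : ℕ) (h : k + 2 < n + 2),
      (A (pth ⟨k, by omega⟩) (pth ⟨k + 1, by omega⟩) ∧
         A (pth ⟨k + 2, h⟩) (pth ⟨k + 1, by omega⟩) →
        (pth ⟨k + 1, by omega⟩ ∈ Z ∨ ∃ d ∈ Z, Ancestor A (pth ⟨k + 1, by omega⟩) d)) ∧
      (¬ (A (pth ⟨k, by omega⟩) (pth ⟨k + 1, by omega⟩) ∧
            A (pth ⟨k + 2, h⟩) (pth ⟨k + 1, by omega⟩)) →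
        pth ⟨k + 1, by omega⟩ ∉ Z))

/-- `u` and `v` are d-separated by `Z`. -/
def DSep (A : V → V → Prop) (Z : Set V) (u v : V) : Prop := ¬ DConn A Z u v

/-- The node sets `X` and `Y` are d-separated by `Z`. -/
def DSepSet (A : V → V → Prop) (Z X Y : Set V) : Prop :=
  ∀ x ∈ X, ∀ y ∈ Y, DSep A Z x y

variable {S : V → Type*}

/-- `p` is a probability mass function on the joint state space. -/
def IsDist [Fintype V] [DecidableEq V] [∀ v, Fintype (S v)]
    (p : (∀ v, S v) → ℝ) : Prop :=
  (∀ f, 0 ≤ p f) ∧ ∑ f, p f = 1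

/-- Marginal probability, under `p`, of the event that the variables in `X` take
the values prescribed by the assignment `a`. -/
noncomputable def margin [Fintype V] [DecidableEq V] [∀ v, Fintype (S v)]
    (p : (∀ v, S v) → ℝ) (X : Set V) (a : ∀ v, S v) : ℝ :=
  ∑ f : ∀ v, S v, if ∀ v ∈ X, f v = a v then p f else 0

/-- Conditional independence `X ⊥ Y | Z` in `p`, in cross-multiplied form:
for every assignment whose `Z`-part has positive probability,
`P(X,Y,Z) · P(Z) = P(X,Z) · P(Y,Z)`. -/
def CondIndep [Fintype V] [DecidableEq V] [∀ v, Fintype (S v)]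
    (p : (∀ v, S v) → ℝ) (X Y Z : Set V) : Prop :=
  ∀ a : ∀ v, S v, 0 < margin p Z a →
    margin p (X ∪ Y ∪ Z) a * margin p Z a = margin p (X ∪ Z) a * margin p (Y ∪ Z) a

/-- `p` is faithful to the DAG `A`: conditional independence coincides with
d-separation for all pairwise disjoint `X`, `Y`, `Z` with `X`, `Y` nonempty. -/
def Faithful [Fintype V] [DecidableEq V] [∀ v, Fintype (S v)]
    (p : (∀ v, S v) → ℝ) (A : V → V → Prop) : Prop :=
  ∀ X Y Z : Set V, X.Nonempty → Y.Nonempty →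
    Disjoint X Y → Disjoint X Z → Disjoint Y Z →
    (CondIndep p X Y Z ↔ DSepSet A Z X Y)

/-- `p` is groupwise faithful to the group DAG `H` given the grouping whose groups
are the fibers of the surjection `π`. -/
def GroupwiseFaithful [Fintype V] [DecidableEq V] [∀ v, Fintype (S v)]
    (p : (∀ v, S v) → ℝ) (π : V → I) (H : I → I → Prop) : Prop :=
  ∀ i j : I, i ≠ j → ∀ T : Set I, i ∉ T → j ∉ T →
    (CondIndep p (π ⁻¹' {i}) (π ⁻¹' {j}) (π ⁻¹' T) ↔ DSep H T i j)

/-- The variable DAG `A` is groupwise Markov equivalent to the group DAG `H`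
given the grouping whose groups are the fibers of the surjection `π`. -/
def GroupwiseMarkovEquiv (A : V → V → Prop) (π : V → I) (H : I → I → Prop) : Prop :=
  ∀ i j : I, i ≠ j → ∀ T : Set I, i ∉ T → j ∉ T →
    (DSepSet A (π ⁻¹' T) (π ⁻¹' {i}) (π ⁻¹' {j}) ↔ DSep H T i j)

/-- `f 0, …, f n` is a path (of length `n`, possibly zero) whose interior nodes are all
active given `Z`. -/
def ActivePath (A : V → V → Prop) (Z : Set V) (f : ℕ → V) (n : ℕ) : Prop :=
  (∀ i j, i ≤ n → j ≤ n → f i = f j → i = j) ∧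
  (∀ k, k + 1 ≤ n → Adj A (f k) (f (k + 1))) ∧
  (∀ k, k + 2 ≤ n →
    (A (f k) (f (k + 1)) ∧ A (f (k + 2)) (f (k + 1)) →
      (f (k + 1) ∈ Z ∨ ∃ d ∈ Z, Ancestor A (f (k + 1)) d)) ∧
    (¬ (A (f k) (f (k + 1)) ∧ A (f (k + 2)) (f (k + 1))) → f (k + 1) ∉ Z))

theorem dConn_iff_exists_activePath {A : V → V → Prop} {Z : Set V} {u v : V} :
    DConn A Z u v ↔ ∃ f n, 1 ≤ n ∧ ActivePath A Z f n ∧ f 0 = u ∧ f n = v := by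
  constructor
  · rintro ⟨n, q, hinj, h0, hl, hadj, hact⟩
    have hq : ∀ k (h : k < n + 2),
        (fun k => if h : k < n + 2 then q ⟨k, h⟩ else u) k = q ⟨k, h⟩ := fun k h => by simp [h]
    refine ⟨fun k => if h : k < n + 2 then q ⟨k, h⟩ else u, n + 1, by omega, ⟨?_, ?_, ?_⟩, ?_, ?_⟩
    · intro i j hi hj hij
      rw [hq i (by omega), hq j (by omega)] at hij
      simpa using hinj hij
    · intro k hk
      rw [hq k (by omega), hq (k + 1) (by omega)]
      exact hadj k (by omega)
    · intro k hk
      rw [hq k (by omega), hq (k + 1) (by omega), hq (k + 2) (by omega)]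
      exact hact k (by omega)
    · rw [hq 0 (by omega)]; exact h0
    · rw [hq (n + 1) (by omega)]; exact hl
  · rintro ⟨f, n, hn, ⟨hinj, hadj, hact⟩, h0, hl⟩
    obtain ⟨n, rfl⟩ := Nat.exists_eq_add_of_le' hn
    refine ⟨n, fun k => f k, ?_, h0, hl, ?_, ?_⟩
    · intro i j hij
      exact Fin.ext (hinj i j (by omega) (by omega) hij)
    · intro k hk
      exact hadj k (by omega)
    · intro k hk
      exact hact k (by omega)

theorem ActivePath.reverse {A : V → V → Prop} {Z : Set V} {f : ℕ → V} {n : ℕ}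
    (hf : ActivePath A Z f n) : ActivePath A Z (fun k => f (n - k)) n := by
  obtain ⟨hinj, hadj, hact⟩ := hf
  refine ⟨?_, ?_, ?_⟩
  · intro i j hi hj hij
    have := hinj _ _ (by omega) (by omega) hij
    omega
  · intro k hk
    have := hadj (n - (k + 1)) (by omega)
    rw [show n - (k + 1) + 1 = n - k by omega] at this
    exact this.symm
  · intro k hk
    have := hact (n - (k + 2)) (by omega)
    rw [show n - (k + 2) + 1 = n - (k + 1) by omega,
      show n - (k + 2) + 2 = n - k by omega] at this
    exact ⟨fun h => this.1 h.symm, fun h => this.2 fun h' => h h'.symm⟩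

theorem DConn.symm {A : V → V → Prop} {Z : Set V} {u v : V} (h : DConn A Z u v) :
    DConn A Z v u := by
  obtain ⟨f, n, hn, hf, h0, hl⟩ := dConn_iff_exists_activePath.1 h
  exact dConn_iff_exists_activePath.2 ⟨_, n, hn, hf.reverse, by simpa using hl, by simpa using h0⟩

theorem DSep.symm {A : V → V → Prop} {Z : Set V} {u v : V} (h : DSep A Z u v) :
    DSep A Z v u :=
  fun h' => h h'.symm

theorem ActivePath.suffix {A : V → V → Prop} {Z : Set V} {f : ℕ → V} {n k : ℕ}
    (hf : ActivePath A Z f n) (hk : k ≤ n) : ActivePath A Z (fun i => f (k + i)) (n - k) := by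
  obtain ⟨hinj, hadj, hact⟩ := hf
  refine ⟨?_, fun i hi => hadj (k + i) (by omega), fun i hi => hact (k + i) (by omega)⟩
  intro i j hi hj hij
  have := hinj _ _ (by omega) (by omega) hij
  omega

theorem ActivePath.cons {A : V → V → Prop} (hA : IsDAG A) {Z : Set V} {f : ℕ → V} {n : ℕ}
    (hf : ActivePath A Z f n) {c : V} (hc : ∀ i ≤ n, f i ≠ c) (harc : A (f 0) c)
    (h0 : f 0 ∉ Z) : ActivePath A Z (fun k => Nat.casesOn k c f) (n + 1) := by
  obtain ⟨hinj, hadj, hact⟩ := hf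
  refine ⟨?_, ?_, ?_⟩
  · rintro (_ | i) (_ | j) hi hj hij
    · rfl
    · exact absurd hij.symm (hc j (by omega))
    · exact absurd hij (hc i (by omega))
    · rw [hinj i j (by omega) (by omega) hij]
  · rintro (_ | k) hk
    · exact Or.inr harc
    · exact hadj k (by omega)
  · rintro (_ | k) hk
    · exact ⟨fun h => absurd ((Relation.TransGen.single harc).tail h.1) (hA _), fun _ => h0⟩
    · exact hact k (by omega)

/-- If conditioning on `w` in addition to `Z` is not needed to activate the colliders of an
active path, it is active given `Z`. -/
theorem ActivePath.of_insert {A : V → V → Prop} {Z : Set V} {w : V} {f : ℕ → V} {n : ℕ}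
    (hf : ActivePath A (insert w Z) f n)
    (hw : ∀ k, 1 ≤ k → k ≤ n → f k ∉ Z → (∀ d ∈ Z, ¬ Ancestor A (f k) d) →
      ¬ Relation.ReflTransGen A (f k) w) : ActivePath A Z f n := by
  obtain ⟨hinj, hadj, hact⟩ := hf
  refine ⟨hinj, hadj, fun k hk => ⟨fun h => ?_, fun h hZ => (hact k hk).2 h (Or.inr hZ)⟩⟩
  by_contra! hcon
  refine hw (k + 1) (by omega) (by omega) hcon.1 hcon.2 ?_
  rcases (hact k hk).1 h with (h1 | h1) | ⟨d, rfl | hd, h1⟩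
  · rw [h1]
  · exact absurd h1 hcon.1
  · exact h1.to_reflTransGen
  · exact absurd h1 (hcon.2 d hd)

theorem DConn.of_insert {A : V → V → Prop} (hA : IsDAG A) {Z : Set V} {w x y : V} (hwy : w ≠ y)
    (h : DConn A (insert w Z) x y) : DConn A Z x y ∨ DConn A Z w y := by
  obtain ⟨f, n, hn, hf, h0, hl⟩ := dConn_iff_exists_activePath.1 h
  set R : Set V := {v | v ∉ Z ∧ (∀ d ∈ Z, ¬ Ancestor A v d) ∧ Relation.ReflTransGen A v w} with hR
  by_cases hex : ∃ k, k ≤ n ∧ f k ∈ R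
  swap
  · left
    refine dConn_iff_exists_activePath.2 ⟨f, n, hn, hf.of_insert ?_, h0, hl⟩
    intro k _ hk h1 h2 h3
    exact hex ⟨k, hk, h1, h2, h3⟩
  right
  obtain ⟨k, ⟨hkn, hkR⟩, hmax⟩ : ∃ k, (k ≤ n ∧ f k ∈ R) ∧ ∀ j, k < j → j ≤ n → f j ∉ R := by
    obtain ⟨k₀, hk₀, hR₀⟩ := hex
    have hk := Nat.findGreatest_spec (P := fun k => f k ∈ R) hk₀ hR₀
    exact ⟨_, ⟨Nat.findGreatest_le n, hk⟩,
      fun j hj hjn => Nat.findGreatest_is_greatest hj hjn⟩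
  have key : ∀ v, Relation.ReflTransGen A (f k) v → v ∈ R →
      ∃ g m, ActivePath A Z g m ∧ g 0 = v ∧ g m = y ∧
        ∀ i ≤ m, g i ∈ R → Relation.ReflTransGen A (g i) v := by
    intro v hv
    induction hv with
    | refl =>
      intro _
      refine ⟨fun i => f (k + i), n - k, (hf.suffix hkn).of_insert ?_, rfl, ?_, ?_⟩
      · intro i hi hin h1 h2 h3
        exact hmax (k + i) (by omega) (by omega) ⟨h1, h2, h3⟩
      · simpa [Nat.add_sub_cancel' hkn] using hl
      · intro i hi hiR
        rcases Nat.eq_zero_or_pos i with rfl | hpos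
        · exact .refl
        · exact absurd hiR (hmax (k + i) (by omega) (by omega))
    | @tail b c hb hbc ih =>
      intro hc
      have hbR : b ∈ R := by
        refine ⟨?_, fun d hd hbd => hkR.2.1 d hd (hbd.trans_right hb), .head hbc hc.2.2⟩
        rcases Relation.reflTransGen_iff_eq_or_transGen.1 hb with rfl | hb
        · exact hkR.1
        · exact fun hbZ => hkR.2.1 b hbZ hb
      obtain ⟨g, m, hg, rfl, hgy, hgR⟩ := ih hbR
      refine ⟨_, m + 1, hg.cons hA (c := c) ?_ hbc hbR.1, rfl, hgy, ?_⟩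
      · rintro i hi rfl
        exact hA _ (.head' hbc (hgR i hi hc))
      · rintro (_ | i) hi hiR
        · exact .refl
        · exact (hgR i (by omega) hiR).tail hbc
  have hwR : w ∈ R := by
    refine ⟨?_, fun d hd hwd => hkR.2.1 d hd (hwd.trans_right hkR.2.2), .refl⟩
    rcases Relation.reflTransGen_iff_eq_or_transGen.1 hkR.2.2 with hw | hw
    · rw [hw]; exact hkR.1
    · exact fun hwZ => hkR.2.1 w hwZ hw
  obtain ⟨g, m, hg, hg0, hgm, -⟩ := key w hkR.2.2 hwR
  refine dConn_iff_exists_activePath.2 ⟨g, m, ?_, hg, hg0, hgm⟩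
  rcases Nat.eq_zero_or_pos m with rfl | hm
  · exact absurd (hg0.symm.trans hgm) hwy
  · exact hm

theorem DSep.insert_cond {A : V → V → Prop} (hA : IsDAG A) {Z : Set V} {w x y : V} (hwy : w ≠ y)
    (hx : DSep A Z x y) (hw : DSep A Z w y) : DSep A (insert w Z) x y :=
  fun h => (h.of_insert hA hwy).elim hx hw

theorem DConn.map {A : V → V → Prop} {H : I → I → Prop} {Z : Set V} {T : Set I} {π : V → I}
    (hπ : Function.Injective π) (hA : ∀ u v, H (π u) (π v) ↔ A u v)
    (hZ : ∀ v, π v ∈ T ↔ v ∈ Z) {u v : V} (h : DConn A Z u v) : DConn H T (π u) (π v) := by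
  obtain ⟨n, q, hinj, h0, hl, hadj, hact⟩ := h
  refine ⟨n, π ∘ q, hπ.comp hinj, by simp [h0], by simp [hl], ?_, ?_⟩
  · intro k hk
    simpa [Adj, hA] using hadj k hk
  · intro k hk
    simp only [Function.comp_apply, hA, hZ]
    refine ⟨fun h => ?_, (hact k hk).2⟩
    refine ((hact k hk).1 h).imp_right ?_
    rintro ⟨d, hd, hanc⟩
    exact ⟨π d, (hZ d).2 hd, Relation.TransGen.lift π (fun a b hab => (hA a b).2 hab) _ _ hanc⟩

theorem dConn_comap_iff (e : V ≃ I) (H : I → I → Prop) (T : Set I) (u v : V) :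
    DConn (fun u v => H (e u) (e v)) (e ⁻¹' T) u v ↔ DConn H T (e u) (e v) := by
  refine ⟨fun h => h.map e.injective (by simp) (by simp), fun h => ?_⟩
  simpa using h.map (A := H) (H := fun u v => H (e u) (e v)) (T := e ⁻¹' T) e.symm.injective
    (by simp) (by simp)

section CondIndep

variable [Fintype V] [DecidableEq V] [∀ v, Fintype (S v)] {p : (∀ v, S v) → ℝ}

theorem margin_nonneg (hp : ∀ f, 0 ≤ p f) (X : Set V) (a : ∀ v, S v) : 0 ≤ margin p X a :=
  Finset.sum_nonneg fun f _ => by split_ifs <;> simp [hp f]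

theorem margin_anti (hp : ∀ f, 0 ≤ p f) {X Y : Set V} (h : X ⊆ Y) (a : ∀ v, S v) :
    margin p Y a ≤ margin p X a := by
  refine Finset.sum_le_sum fun f _ => ?_
  by_cases hY : ∀ v ∈ Y, f v = a v
  · rw [if_pos hY, if_pos fun v hv => hY v (h hv)]
  · rw [if_neg hY]
    split_ifs <;> simp [hp f]

theorem margin_congr {X : Set V} {a b : ∀ v, S v} (h : ∀ v ∈ X, a v = b v) :
    margin p X a = margin p X b := by
  refine Finset.sum_congr rfl fun f _ => ?_
  have : (∀ v ∈ X, f v = a v) ↔ ∀ v ∈ X, f v = b v :=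
    forall₂_congr fun v hv => by rw [h v hv]
  simp only [this]

theorem margin_update {X : Set V} {v : V} (hv : v ∉ X) (a : ∀ v, S v) (s : S v) :
    margin p X (Function.update a v s) = margin p X a :=
  margin_congr fun u hu => Function.update_of_ne (by rintro rfl; exact hv hu) _ _

theorem sum_margin_insert {X : Set V} {v : V} (hv : v ∉ X) (a : ∀ v, S v) :
    ∑ s, margin p (insert v X) (Function.update a v s) = margin p X a := by
  unfold margin
  rw [Finset.sum_comm]
  refine Finset.sum_congr rfl fun f _ => ?_
  have : ∀ s, (∀ u ∈ insert v X, f u = Function.update a v s u) ↔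
      f v = s ∧ ∀ u ∈ X, f u = a u := by
    intro s
    rw [Set.forall_mem_insert, Function.update_self]
    refine and_congr_right fun _ => forall₂_congr fun u hu => ?_
    rw [Function.update_of_ne (by rintro rfl; exact hv hu)]
  simp only [this, ite_and]
  simp

theorem CondIndep.symm {X Y Z : Set V} (h : CondIndep p X Y Z) : CondIndep p Y X Z := by
  intro a ha
  rw [Set.union_comm Y X, h a ha, mul_comm]

theorem CondIndep.of_insert {X Y Z : Set V} {x : V} (hX : x ∉ X) (hY : x ∉ Y) (hZ : x ∉ Z)
    (h : CondIndep p (insert x X) Y Z) : CondIndep p X Y Z := by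
  intro a ha
  have hXYZ : x ∉ X ∪ Y ∪ Z := by simp [hX, hY, hZ]
  have hXZ : x ∉ X ∪ Z := by simp [hX, hZ]
  have hYZ : x ∉ Y ∪ Z := by simp [hY, hZ]
  rw [← sum_margin_insert hXYZ, ← sum_margin_insert hXZ, Finset.sum_mul, Finset.sum_mul]
  refine Finset.sum_congr rfl fun s _ => ?_
  have := h (Function.update a x s) (by rwa [margin_update hZ])
  rwa [Set.insert_union, Set.insert_union, Set.insert_union, margin_update hZ,
    margin_update hYZ] at this

theorem CondIndep.singleton_left {X Y Z : Set V} (hXY : Disjoint X Y) (hXZ : Disjoint X Z) {x : V}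
    (hx : x ∈ X) (h : CondIndep p X Y Z) : CondIndep p {x} Y Z := by
  suffices ∀ W : Set V, x ∉ W → Disjoint W Y → Disjoint W Z →
      CondIndep p (W ∪ {x}) Y Z → CondIndep p {x} Y Z by
    refine this (X \ {x}) (by simp) (hXY.mono_left Set.sdiff_subset)
      (hXZ.mono_left Set.sdiff_subset) ?_
    rwa [Set.sdiff_union_of_subset (by simpa using hx)]
  intro W
  induction W, W.toFinite using Set.Finite.induction_on with
  | empty => simp
  | @insert w W hw _ ih =>
    intro hxW hWY hWZ h
    rw [Set.disjoint_insert_left] at hWY hWZ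
    rw [Set.mem_insert_iff, not_or] at hxW
    rw [Set.insert_union] at h
    exact ih hxW.2 hWY.2 hWZ.2 (h.of_insert (by simp [hw, Ne.symm hxW.1]) hWY.1 hWZ.1)

/-- The contraction property of conditional independence. -/
theorem CondIndep.insert_left (hp : ∀ f, 0 ≤ p f) {X Y Z : Set V} {x : V}
    (hx : CondIndep p {x} Y Z) (hX : CondIndep p X Y (insert x Z)) :
    CondIndep p (insert x X) Y Z := by
  intro a ha
  have e1 : insert x X ∪ Y ∪ Z = X ∪ Y ∪ insert x Z := by ext; simp; tauto
  have e2 : insert x X ∪ Z = X ∪ insert x Z := by ext; simp; tauto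
  have e3 : {x} ∪ Y ∪ Z = Y ∪ insert x Z := by ext; simp; tauto
  rw [e1, e2]
  have h1 := hx a ha
  rw [e3, Set.singleton_union] at h1
  rcases (margin_nonneg hp (insert x Z) a).eq_or_lt with h0 | h0
  · have hz : ∀ W, insert x Z ⊆ W → margin p W a = 0 := fun W hW =>
      le_antisymm ((margin_anti hp hW a).trans h0.ge) (margin_nonneg hp W a)
    rw [hz _ Set.subset_union_right, hz _ Set.subset_union_right, zero_mul, zero_mul]
  · have h2 := hX a h0
    refine mul_right_cancel₀ h0.ne' ?_
    linear_combination margin p Z a * h2 + margin p (X ∪ insert x Z) a * h1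

theorem condIndep_empty_left (Y Z : Set V) : CondIndep p ∅ Y Z := by
  intro a _
  rw [Set.empty_union, Set.empty_union, mul_comm]

variable {A : V → V → Prop}

theorem condIndep_singleton_right_of_dSep (hA : IsDAG A) (hp : ∀ f, 0 ≤ p f)
    (hpair : ∀ x y, x ≠ y → ∀ Z, x ∉ Z → y ∉ Z → DSep A Z x y → CondIndep p {x} {y} Z)
    {y : V} (X : Set V) : ∀ Z, y ∉ X → y ∉ Z → Disjoint X Z → (∀ x ∈ X, DSep A Z x y) →
      CondIndep p X {y} Z := by
  induction X, X.toFinite using Set.Finite.induction_on with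
  | empty => exact fun Z _ _ _ _ => condIndep_empty_left _ _
  | @insert x X hx _ ih =>
    intro Z hyX hyZ hXZ hsep
    rw [Set.disjoint_insert_left] at hXZ
    rw [Set.mem_insert_iff, not_or] at hyX
    rw [Set.forall_mem_insert] at hsep
    refine (hpair x y (Ne.symm hyX.1) Z hXZ.1 hyZ hsep.1).insert_left hp (ih _ hyX.2 ?_ ?_ ?_)
    · simp [hyX.1, hyZ]
    · exact Set.disjoint_insert_right.2 ⟨hx, hXZ.2⟩
    · exact fun x' hx' => (hsep.2 x' hx').insert_cond hA (Ne.symm hyX.1) hsep.1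

theorem condIndep_of_dSepSet (hA : IsDAG A) (hp : ∀ f, 0 ≤ p f)
    (hpair : ∀ x y, x ≠ y → ∀ Z, x ∉ Z → y ∉ Z → DSep A Z x y → CondIndep p {x} {y} Z)
    (X Y : Set V) : ∀ Z, Disjoint X Y → Disjoint X Z → Disjoint Y Z → DSepSet A Z X Y →
      CondIndep p X Y Z := by
  induction Y, Y.toFinite using Set.Finite.induction_on with
  | empty => exact fun Z _ _ _ _ => (condIndep_empty_left _ _).symm
  | @insert y Y hy _ ih =>
    intro Z hXY hXZ hYZ hsep
    rw [Set.disjoint_insert_left] at hYZ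
    rw [Set.disjoint_insert_right] at hXY
    have hyX : CondIndep p X {y} Z := condIndep_singleton_right_of_dSep hA hp hpair X Z hXY.1
      hYZ.1 hXZ fun x hx => hsep x hx y (Set.mem_insert _ _)
    refine (hyX.symm.insert_left hp (ih _ hXY.2 ?_ ?_ ?_).symm).symm
    · exact Set.disjoint_insert_right.2 ⟨hXY.1, hXZ⟩
    · exact Set.disjoint_insert_right.2 ⟨hy, hYZ.2⟩
    · intro x hx y' hy'
      exact ((hsep x hx y' (Set.mem_insert_of_mem _ hy')).symm.insert_cond hA
        (by rintro rfl; exact hXY.1 hx) (hsep x hx y (Set.mem_insert _ _)).symm).symm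

/-- Faithfulness may be tested on pairs of single nodes. -/
theorem faithful_of_forall_singleton (hA : IsDAG A) (hp : ∀ f, 0 ≤ p f)
    (hpair : ∀ x y, x ≠ y → ∀ Z, x ∉ Z → y ∉ Z → (CondIndep p {x} {y} Z ↔ DSep A Z x y)) :
    Faithful p A := by
  intro X Y Z _ _ hXY hXZ hYZ
  refine ⟨fun h x hx y hy => ?_, condIndep_of_dSepSet hA hp
    (fun x y hxy Z hxZ hyZ => (hpair x y hxy Z hxZ hyZ).2) X Y Z hXY hXZ hYZ⟩
  refine (hpair x y (hXY.ne_of_mem hx hy) Z (hXZ.notMem_of_mem_left hx)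
    (hYZ.notMem_of_mem_left hy)).1 ?_
  have hxY : Disjoint Y {x} := Set.disjoint_singleton_right.2 (hXY.notMem_of_mem_left hx)
  exact ((h.singleton_left hXY hXZ hx).symm.singleton_left hxY hYZ hy).symm

end CondIndep

/-- Lemma 9 of the paper. If every group is a singleton, then
every distribution that is groupwise faithful to the group DAG `H` given the
grouping is faithful to the DAG on the variables obtained from `H` by identifying
each singleton group with its unique element. -/
theorem groupwise_faithful_singletons_implies_faithful
    {V I : Type*} [Fintype V] [Fintype I] [DecidableEq V]
    {S : V → Type*} [∀ v, Fintype (S v)]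
    (hS : ∀ v : V, 2 ≤ Fintype.card (S v))
    (π : V → I) (hπ : Function.Surjective π)
    (H : I → I → Prop) (hH : IsDAG H)
    (hsize : ∀ i : I, (π ⁻¹' {i}).ncard = 1)
    (p : (∀ v, S v) → ℝ) (hp : IsDist p)
    (hgf : GroupwiseFaithful p π H) :
    IsDAG (fun u v : V => H (π u) (π v)) ∧
      Faithful p (fun u v : V => H (π u) (π v)) := by
  have hinj : Function.Injective π := by
    intro u v huv
    obtain ⟨w, hw⟩ := Set.ncard_eq_one.1 (hsize (π v))
    have hu : u ∈ π ⁻¹' {π v} := huv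
    have hv : v ∈ π ⁻¹' {π v} := rfl
    rw [hw, Set.mem_singleton_iff] at hu hv
    rw [hu, hv]
  have hA : IsDAG (fun u v : V => H (π u) (π v)) :=
    fun v hv => hH (π v) (Relation.TransGen.lift π (fun _ _ h => h) _ _ hv)
  refine ⟨hA, faithful_of_forall_singleton hA hp.1 fun x y hxy Z hxZ hyZ => ?_⟩
  have hfiber : ∀ v, π ⁻¹' {π v} = {v} := fun v => by
    rw [← Set.image_singleton, Set.preimage_image_eq _ hinj]
  have h := hgf (π x) (π y) (hinj.ne hxy) (π '' Z) (by rwa [hinj.mem_set_image])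
    (by rwa [hinj.mem_set_image])
  rw [hfiber, hfiber, Set.preimage_image_eq _ hinj] at h
  have hconn : DConn (fun u v => H (π u) (π v)) (π ⁻¹' (π '' Z)) x y ↔
      DConn H (π '' Z) (π x) (π y) :=
    dConn_comap_iff (Equiv.ofBijective π ⟨hinj, hπ⟩) H (π '' Z) x y
  rw [Set.preimage_image_eq _ hinj] at hconn
  rw [h, DSep, DSep, hconn]

end GroupBN
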